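/- For every word w, the number of words u with fast(u) = w equals the number of trees in R whose postorder reading is w, and the number of words u with slow(u) = w equals the number of trees in L whose postorder reading is w. (All of these sets are finite, since fast and slow preserve the multiset of letters of a word.) -/

import Mathlib

lemma foldr_max_mem {w : List ℕ} (h : w ≠ []) : w.foldr max 0 ∈ w := by
  induction w with
  | nil => exact absurd rfl h
  | cons a l ih =>
    rcases eq_or_ne l [] with rfl | hl
    · simp
    · have hm := ih hl
      simp only [List.foldr_cons]
      rcases max_choice a (l.foldr max 0) with h' | h' <;> rw [h']
      · exact List.mem_cons_self
      · exact List.mem_cons_of_mem _ hm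

lemma headI_mem {α : Type*} [Inhabited α] {l : List α} (h : l ≠ []) : l.headI ∈ l := by
  cases l with
  | nil => exact absurd rfl h
  | cons a t => simp

/-- `blocks n w` is the list of maximal (possibly empty) blocks of `w`
separated by occurrences of the letter `n`; that is, if `n` occurs `k` times
in `w`, then `blocks n w = [A₁, A₂, …, A_{k+1}]` where `w = A₁ n A₂ n ⋯ n A_{k+1}`
and no `Aᵢ` contains the letter `n`. -/
def blocks (n : ℕ) : List ℕ → List (List ℕ)
  | [] => [[]]
  | a :: l =>
    if a = n then [] :: blocks n l
    else (a :: (blocks n l).headI) :: (blocks n l).tail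

lemma blocks_ne_nil (n : ℕ) (w : List ℕ) : blocks n w ≠ [] := by
  cases w with
  | nil => simp [blocks]
  | cons a l =>
    simp only [blocks]
    split <;> simp

lemma blocks_length {n : ℕ} {w : List ℕ} : ∀ {A : List ℕ}, A ∈ blocks n w →
    A.length + w.count n ≤ w.length := by
  induction w with
  | nil =>
    intro A hA
    simp only [blocks, List.mem_singleton] at hA
    subst hA; simp
  | cons a l ih =>
    intro A hA
    by_cases h : a = n
    · subst h
      simp only [blocks, if_pos rfl] at hA
      have hcc : (a :: l).count a = l.count a + 1 := by simp
      cases hA with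
      | head =>
        have := List.count_le_length (a := a) (l := l)
        simp only [List.length_nil, List.length_cons, hcc]
        omega
      | tail _ h1 =>
        have := ih h1
        simp only [List.length_cons, hcc]
        omega
    · simp only [blocks, if_neg h] at hA
      have hcc : (a :: l).count n = l.count n := by
        simp [List.count_cons, h]
      cases hA with
      | head =>
        have := ih (headI_mem (blocks_ne_nil n l))
        simp only [List.length_cons, hcc]
        omega
      | tail _ h1 =>
        have := ih (List.mem_of_mem_tail h1)
        simp only [List.length_cons, hcc]
        omega

/-- The generalized stack-sorting map `fast` (the convention in which a letter may
sit on top of a copy of itself in the stack): `fast ε = ε`, and if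
`w = A₁ n A₂ n ⋯ n A_{k+1}` where `n` is the largest letter of `w` (occurring
`k` times) and the `Aᵢ` contain only letters smaller than `n`, then
`fast w = fast A₁ ++ fast A₂ ++ ⋯ ++ fast A_{k+1} ++ n ⋯ n` (with `k` copies of `n`). -/
def fast (w : List ℕ) : List ℕ :=
  if h : w = [] then []
  else
    ((blocks (w.foldr max 0) w).attach.map
      fun (A : {x // x ∈ blocks (w.foldr max 0) w}) =>
      have : A.1.length < w.length := by
        have h1 := blocks_length A.2
        have h2 : 0 < w.count (w.foldr max 0) :=
          List.count_pos_iff.mpr (foldr_max_mem h)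
        omega
      fast A.1).flatten ++ List.replicate (w.count (w.foldr max 0)) (w.foldr max 0)
termination_by w.length

/-- The generalized stack-sorting map `slow` (the convention in which a letter may
not sit on top of a copy of itself in the stack): `slow ε = ε`, and if
`w = A₁ n A₂ n ⋯ n A_{k+1}` where `n` is the largest letter of `w` (occurring
`k` times) and the `Aᵢ` contain only letters smaller than `n`, then
`slow w = slow A₁ ++ slow A₂ ++ [n] ++ slow A₃ ++ [n] ++ ⋯ ++ slow A_{k+1} ++ [n]`. -/
def slow (w : List ℕ) : List ℕ :=
  if h : w = [] then []
  else
    (have : (blocks (w.foldr max 0) w).headI.length < w.length := by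
      have h1 := blocks_length (headI_mem (blocks_ne_nil (w.foldr max 0) w))
      have h2 : 0 < w.count (w.foldr max 0) :=
        List.count_pos_iff.mpr (foldr_max_mem h)
      omega
     slow (blocks (w.foldr max 0) w).headI) ++
    ((blocks (w.foldr max 0) w).tail.attach.map
      fun (A : {x // x ∈ (blocks (w.foldr max 0) w).tail}) =>
      have : A.1.length < w.length := by
        have h1 := blocks_length (List.mem_of_mem_tail A.2)
        have h2 : 0 < w.count (w.foldr max 0) :=
          List.count_pos_iff.mpr (foldr_max_mem h)
        omega
      slow A.1 ++ [w.foldr max 0]).flatten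
termination_by w.length

/-- Binary plane trees labeled by natural numbers: each vertex carries a label and
an ordered pair of (possibly empty) left and right subtrees. -/
inductive BTree where
  | leaf : BTree
  | node : BTree → ℕ → BTree → BTree

/-- The in-order (symmetric order) reading of a labeled binary plane tree. -/
def BTree.inOrder : BTree → List ℕ
  | .leaf => []
  | .node l v r => l.inOrder ++ v :: r.inOrder

/-- The postorder reading of a labeled binary plane tree. -/
def BTree.postOrder : BTree → List ℕ
  | .leaf => []
  | .node l v r => l.postOrder ++ r.postOrder ++ [v]

/-- The label of the root of a binary plane tree, if the tree is nonempty. -/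
def BTree.root? : BTree → Option ℕ
  | .leaf => none
  | .node _ v _ => some v

/-- The tree is weakly decreasing: the label of each nonroot vertex is at most
the label of its parent. -/
def BTree.WeaklyDecreasing : BTree → Prop
  | .leaf => True
  | .node l v r => (∀ x ∈ l.inOrder, x ≤ v) ∧ (∀ x ∈ r.inOrder, x ≤ v) ∧
      l.WeaklyDecreasing ∧ r.WeaklyDecreasing

/-- All labels of the tree are positive integers. -/
def BTree.PosLabels : BTree → Prop
  | .leaf => True
  | .node l v r => 0 < v ∧ l.PosLabels ∧ r.PosLabels

/-- No vertex has the same label as its left child. -/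
def BTree.NoLeftEq : BTree → Prop
  | .leaf => True
  | .node l v r => l.root? ≠ some v ∧ l.NoLeftEq ∧ r.NoLeftEq

/-- No vertex has the same label as its right child. -/
def BTree.NoRightEq : BTree → Prop
  | .leaf => True
  | .node l v r => r.root? ≠ some v ∧ l.NoRightEq ∧ r.NoRightEq

/-- `τ ∈ R`: a weakly decreasing binary plane tree (labeled by positive integers)
in which no vertex has the same label as its left child. -/
def BTree.InR (t : BTree) : Prop := t.WeaklyDecreasing ∧ t.PosLabels ∧ t.NoLeftEq

/-- `τ ∈ L`: a weakly decreasing binary plane tree (labeled by positive integers)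
in which no vertex has the same label as its right child. -/
def BTree.InL (t : BTree) : Prop := t.WeaklyDecreasing ∧ t.PosLabels ∧ t.NoRightEq

lemma foldr_max_eq_of_forall_le {w : List ℕ} {n : ℕ} (hn : n ∈ w) (h : ∀ x ∈ w, x ≤ n) :
    w.foldr max 0 = n :=
  le_antisymm (h _ (foldr_max_mem (List.ne_nil_of_mem hn)))
    (List.le_max_of_le' 0 hn le_rfl)

lemma blocks_of_notMem {n : ℕ} {w : List ℕ} (h : n ∉ w) : blocks n w = [w] := by
  induction w with
  | nil => rfl
  | cons a l ih =>
    simp only [List.mem_cons, not_or] at h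
    simp [blocks, Ne.symm h.1, ih h.2]

lemma blocks_append_cons (n : ℕ) (A B : List ℕ) :
    blocks n (A ++ n :: B) = blocks n A ++ blocks n B := by
  induction A with
  | nil => simp [blocks]
  | cons a l ih =>
    simp only [List.cons_append, blocks, ih]
    obtain ⟨b, t, hb⟩ := List.exists_cons_of_ne_nil (blocks_ne_nil n l)
    split <;> simp [hb]

lemma fast_nil : fast [] = [] := by
  rw [fast]; simp

lemma slow_nil : slow [] = [] := by
  rw [slow]; simp

lemma fast_eq_of_forall_le {w : List ℕ} {n : ℕ} (h : ∀ x ∈ w, x ≤ n) :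
    fast w = ((blocks n w).map fast).flatten ++ List.replicate (w.count n) n := by
  by_cases hn : n ∈ w
  · obtain rfl := foldr_max_eq_of_forall_le hn h
    rw [fast, dif_neg (List.ne_nil_of_mem hn)]
    simp only [List.map_subtype, List.unattach_attach]
  · simp [blocks_of_notMem hn, List.count_eq_zero_of_not_mem hn]

lemma slow_eq_of_forall_le {w : List ℕ} {n : ℕ} (h : ∀ x ∈ w, x ≤ n) :
    slow w = slow (blocks n w).headI ++
      ((blocks n w).tail.map fun A => slow A ++ [n]).flatten := by
  by_cases hn : n ∈ w
  · obtain rfl := foldr_max_eq_of_forall_le hn h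
    rw [slow, dif_neg (List.ne_nil_of_mem hn)]
    simp only [List.map_subtype, List.unattach_attach]
  · simp [blocks_of_notMem hn]

/-- `fast` splits off the first occurrence of the largest letter. -/
lemma fast_append_cons {A B : List ℕ} {n : ℕ} (hA : ∀ x ∈ A, x ≤ n) (hn : n ∉ A)
    (hB : ∀ x ∈ B, x ≤ n) : fast (A ++ n :: B) = fast A ++ fast B ++ [n] := by
  have h : ∀ x ∈ A ++ n :: B, x ≤ n := by
    intro x hx
    rcases List.mem_append.1 hx with hx | hx
    · exact hA x hx
    · rcases List.mem_cons.1 hx with rfl | hx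
      · exact le_rfl
      · exact hB x hx
  rw [fast_eq_of_forall_le h, fast_eq_of_forall_le hB, blocks_append_cons, blocks_of_notMem hn]
  simp [List.count_eq_zero_of_not_mem hn, List.replicate_succ']

/-- `slow` splits off the last occurrence of the largest letter. -/
lemma slow_append_cons {A B : List ℕ} {n : ℕ} (hA : ∀ x ∈ A, x ≤ n)
    (hB : ∀ x ∈ B, x ≤ n) (hn : n ∉ B) : slow (A ++ n :: B) = slow A ++ slow B ++ [n] := by
  have h : ∀ x ∈ A ++ n :: B, x ≤ n := by
    intro x hx
    rcases List.mem_append.1 hx with hx | hx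
    · exact hA x hx
    · rcases List.mem_cons.1 hx with rfl | hx
      · exact le_rfl
      · exact hB x hx
  rw [slow_eq_of_forall_le h, slow_eq_of_forall_le hA, blocks_append_cons, blocks_of_notMem hn]
  obtain ⟨b, t, hb⟩ := List.exists_cons_of_ne_nil (blocks_ne_nil n A)
  simp [hb]

namespace BTree

/-- The reflection of a binary plane tree, exchanging left and right subtrees. -/
def mirror : BTree → BTree
  | .leaf => .leaf
  | .node l v r => .node r.mirror v l.mirror

lemma mirror_mirror (t : BTree) : t.mirror.mirror = t := by
  induction t with
  | leaf => rfl
  | node l v r ihl ihr => simp [mirror, ihl, ihr]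

lemma inOrder_mirror (t : BTree) : t.mirror.inOrder = t.inOrder.reverse := by
  induction t with
  | leaf => rfl
  | node l v r ihl ihr => simp [mirror, inOrder, ihl, ihr]

lemma root?_mirror (t : BTree) : t.mirror.root? = t.root? := by
  cases t <;> rfl

lemma weaklyDecreasing_mirror {t : BTree} (h : t.WeaklyDecreasing) :
    t.mirror.WeaklyDecreasing := by
  induction t with
  | leaf => trivial
  | node l v r ihl ihr =>
    obtain ⟨h1, h2, h3, h4⟩ := h
    exact ⟨by simpa [inOrder_mirror] using h2, by simpa [inOrder_mirror] using h1,
      ihr h4, ihl h3⟩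

lemma noLeftEq_mirror {t : BTree} (h : t.NoRightEq) : t.mirror.NoLeftEq := by
  induction t with
  | leaf => trivial
  | node l v r ihl ihr => exact ⟨by simpa [root?_mirror] using h.1, ihr h.2.2, ihl h.2.1⟩

lemma noRightEq_mirror {t : BTree} (h : t.NoLeftEq) : t.mirror.NoRightEq := by
  induction t with
  | leaf => trivial
  | node l v r ihl ihr => exact ⟨by simpa [root?_mirror] using h.1, ihr h.2.2, ihl h.2.1⟩

lemma posLabels_iff (t : BTree) : t.PosLabels ↔ 0 ∉ t.inOrder := by
  induction t with
  | leaf => simp [PosLabels, inOrder]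
  | node l v r ihl ihr =>
    simp only [PosLabels, inOrder, ihl, ihr, List.mem_append, List.mem_cons, Nat.pos_iff_ne_zero]
    grind

lemma postOrder_perm (t : BTree) : t.postOrder.Perm t.inOrder := by
  induction t with
  | leaf => exact .nil
  | node l v r ihl ihr =>
    simp only [postOrder, inOrder, List.append_assoc]
    exact ihl.append ((List.perm_append_singleton _ _).trans (ihr.cons _))

/-- In a weakly decreasing tree, a subtree not rooted at its bound `v` avoids `v`. -/
lemma notMem_inOrder {t : BTree} {v : ℕ} (ht : t.WeaklyDecreasing)
    (hv : ∀ x ∈ t.inOrder, x ≤ v) (hr : t.root? ≠ some v) : v ∉ t.inOrder := by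
  cases t with
  | leaf => simp [inOrder]
  | node l a r =>
    obtain ⟨h1, h2, -, -⟩ := ht
    have ha : a ≤ v := hv a (by simp [inOrder])
    have hne : a ≠ v := by simpa [root?] using hr
    intro hmem
    simp only [inOrder, List.mem_append, List.mem_cons] at hmem
    rcases hmem with h | h | h
    · have := h1 _ h; omega
    · omega
    · have := h2 _ h; omega

lemma fast_inOrder {t : BTree} (h : t.WeaklyDecreasing) (h' : t.NoLeftEq) :
    fast t.inOrder = t.postOrder := by
  induction t with
  | leaf => exact fast_nil
  | node l v r ihl ihr =>
    obtain ⟨h1, h2, h3, h4⟩ := h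
    obtain ⟨h5, h6, h7⟩ := h'
    rw [inOrder, fast_append_cons h1 (notMem_inOrder h3 h1 h5) h2, ihl h3 h6, ihr h4 h7, postOrder]

lemma slow_inOrder {t : BTree} (h : t.WeaklyDecreasing) (h' : t.NoRightEq) :
    slow t.inOrder = t.postOrder := by
  induction t with
  | leaf => exact slow_nil
  | node l v r ihl ihr =>
    obtain ⟨h1, h2, h3, h4⟩ := h
    obtain ⟨h5, h6, h7⟩ := h'
    rw [inOrder, slow_append_cons h1 h2 (notMem_inOrder h4 h2 h5), ihl h3 h6, ihr h4 h7, postOrder]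

lemma exists_noLeftEq_inOrder_eq (u : List ℕ) :
    ∃ t : BTree, (t.WeaklyDecreasing ∧ t.NoLeftEq) ∧ t.inOrder = u := by
  induction hk : u.length using Nat.strong_induction_on generalizing u with
  | _ k ih =>
    subst hk
    rcases eq_or_ne u [] with rfl | hu
    · exact ⟨.leaf, ⟨trivial, trivial⟩, rfl⟩
    have hmax : ∀ x ∈ u, x ≤ u.foldr max 0 := fun x hx => List.le_max_of_le' 0 hx le_rfl
    obtain ⟨A, B, hAB, hA⟩ := List.eq_append_cons_of_mem (foldr_max_mem hu)
    generalize u.foldr max 0 = n at hmax hAB hA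
    subst hAB
    obtain ⟨l, ⟨hl1, hl2⟩, rfl⟩ := ih A.length (by simp) A rfl
    obtain ⟨r, ⟨hr1, hr2⟩, rfl⟩ := ih B.length (by simp; omega) B rfl
    refine ⟨.node l n r, ⟨⟨fun x hx => hmax x (by simp [hx]), fun x hx => hmax x (by simp [hx]),
      hl1, hr1⟩, ?_, hl2, hr2⟩, rfl⟩
    rintro h
    cases l with
    | leaf => simp [root?] at h
    | node l a r =>
      simp only [root?, Option.some.injEq] at h
      exact hA (by simp [inOrder, h])

lemma injOn_inOrder_noLeftEq :
    Set.InjOn inOrder {t : BTree | t.WeaklyDecreasing ∧ t.NoLeftEq} := by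
  rintro s ⟨hs, hs'⟩ t ⟨ht, ht'⟩ h
  induction s generalizing t with
  | leaf =>
    cases t with
    | leaf => rfl
    | node l v r => simp [inOrder] at h
  | node l v r ihl ihr =>
    cases t with
    | leaf => simp [inOrder] at h
    | node l' v' r' =>
      obtain ⟨h1, h2, h3, h4⟩ := hs
      obtain ⟨h5, h6, h7⟩ := hs'
      obtain ⟨k1, k2, k3, k4⟩ := ht
      obtain ⟨k5, k6, k7⟩ := ht'
      have hl := notMem_inOrder h3 h1 h5
      have hl' := notMem_inOrder k3 k1 k5
      simp only [inOrder] at h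
      have hv : v = v' := by
        apply le_antisymm
        · have hm : v ∈ l'.inOrder ++ v' :: r'.inOrder := by simp [← h]
          grind
        · have hm : v' ∈ l.inOrder ++ v :: r.inOrder := by simp [h]
          grind
      subst hv
      have hlen : l.inOrder.length = l'.inOrder.length := by
        simpa [List.idxOf_append, hl, hl'] using congrArg (List.idxOf v) h
      obtain ⟨e1, e2⟩ := List.append_inj h hlen
      rw [ihl h3 h6 k3 k6 e1, ihr h4 h7 k4 k7 (List.cons.inj e2).2]

lemma exists_noRightEq_inOrder_eq (u : List ℕ) :
    ∃ t : BTree, (t.WeaklyDecreasing ∧ t.NoRightEq) ∧ t.inOrder = u := by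
  obtain ⟨t, ⟨h, h'⟩, ht⟩ := exists_noLeftEq_inOrder_eq u.reverse
  exact ⟨t.mirror, ⟨weaklyDecreasing_mirror h, noRightEq_mirror h'⟩, by simp [inOrder_mirror, ht]⟩

lemma injOn_inOrder_noRightEq :
    Set.InjOn inOrder {t : BTree | t.WeaklyDecreasing ∧ t.NoRightEq} := by
  rintro s ⟨hs, hs'⟩ t ⟨ht, ht'⟩ h
  have := injOn_inOrder_noLeftEq ⟨weaklyDecreasing_mirror hs, noLeftEq_mirror hs'⟩
    ⟨weaklyDecreasing_mirror ht, noLeftEq_mirror ht'⟩ (by simp [inOrder_mirror, h])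
  rw [← mirror_mirror s, this, mirror_mirror]

/-- If the in-order reading is a bijection from a class of trees onto all words, and `f` sends the
in-order reading of each tree of the class to its postorder reading, then the fibre of `f` over a
positive word `w` is equinumerous with the positive trees of the class with postorder `w`. -/
lemma finite_and_ncard_eq {f : List ℕ → List ℕ} {p : BTree → Prop}
    (hf : ∀ t, p t → f t.inOrder = t.postOrder) (hinj : Set.InjOn inOrder {t | p t})
    (hsurj : ∀ u, ∃ t, p t ∧ t.inOrder = u) {w : List ℕ} (hw : 0 ∉ w) :
    {u | f u = w}.Finite ∧ {t : BTree | (p t ∧ t.PosLabels) ∧ t.postOrder = w}.Finite ∧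
      {u | f u = w}.ncard = {t : BTree | (p t ∧ t.PosLabels) ∧ t.postOrder = w}.ncard := by
  have hinj' : Set.InjOn inOrder {t : BTree | (p t ∧ t.PosLabels) ∧ t.postOrder = w} :=
    hinj.mono fun t ht => ht.1.1
  have himage : inOrder '' {t : BTree | (p t ∧ t.PosLabels) ∧ t.postOrder = w} =
      {u | f u = w} := by
    ext u
    constructor
    · rintro ⟨t, ⟨⟨ht, -⟩, rfl⟩, rfl⟩
      exact hf t ht
    · intro hu
      obtain ⟨t, ht, rfl⟩ := hsurj u
      have hpost : t.postOrder = w := (hf t ht).symm.trans hu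
      refine ⟨t, ⟨⟨ht, (posLabels_iff t).2 fun h0 => hw ?_⟩, hpost⟩, rfl⟩
      exact hpost ▸ t.postOrder_perm.mem_iff.2 h0
  have hfin : {u | f u = w}.Finite := by
    refine (List.finite_toSet w.permutations).subset ?_
    rw [← himage]
    rintro _ ⟨t, ⟨-, rfl⟩, rfl⟩
    exact List.mem_permutations.2 t.postOrder_perm.symm
  exact ⟨hfin, Set.Finite.of_finite_image (himage ▸ hfin) hinj',
    himage ▸ hinj'.ncard_image⟩

lemma inR_iff (t : BTree) : t.InR ↔ (t.WeaklyDecreasing ∧ t.NoLeftEq) ∧ t.PosLabels := by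
  unfold InR; tauto

lemma inL_iff (t : BTree) : t.InL ↔ (t.WeaklyDecreasing ∧ t.NoRightEq) ∧ t.PosLabels := by
  unfold InL; tauto

end BTree

/-- For every word `w`, the number of words `u` with `fast u = w` equals the number of
trees in `R` whose postorder reading is `w`, and the number of words `u` with
`slow u = w` equals the number of trees in `L` whose postorder reading is `w`
(all these sets are finite). -/
theorem card_preimage_eq_card_trees (w : List ℕ) (hw : 0 ∉ w) :
    {u : List ℕ | fast u = w}.Finite ∧
    {t : BTree | t.InR ∧ t.postOrder = w}.Finite ∧
    {u : List ℕ | fast u = w}.ncard = {t : BTree | t.InR ∧ t.postOrder = w}.ncard ∧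
    {u : List ℕ | slow u = w}.Finite ∧
    {t : BTree | t.InL ∧ t.postOrder = w}.Finite ∧
    {u : List ℕ | slow u = w}.ncard = {t : BTree | t.InL ∧ t.postOrder = w}.ncard := by
  simp only [BTree.inR_iff, BTree.inL_iff]
  obtain ⟨h1, h2, h3⟩ := BTree.finite_and_ncard_eq (fun t ht => BTree.fast_inOrder ht.1 ht.2)
    BTree.injOn_inOrder_noLeftEq BTree.exists_noLeftEq_inOrder_eq hw
  obtain ⟨h4, h5, h6⟩ := BTree.finite_and_ncard_eq (fun t ht => BTree.slow_inOrder ht.1 ht.2)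
    BTree.injOn_inOrder_noRightEq BTree.exists_noRightEq_inOrder_eq hw
  exact ⟨h1, h2, h3, h4, h5, h6⟩
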